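/- Let ℓ > 0, N ≥ 3, T > 0, 0 < a_1 ≤ a_2, and let E_N^ℓ be the discrete heat energy with no-flux conventions. Let x : [0,T] → ℝ^N be an absolutely continuous curve with x(t) ∈ D_ℓ and −ℓ ≤ x_1(t) < ⋯ < x_N(t) ≤ ℓ for all t, satisfying x'(t) ∈ −∂_w E_N^ℓ(x(t)) for almost every t ∈ [0,T]. If x_1(0) = −ℓ, x_N(0) = ℓ, and a_1/N ≤ Δx_i(0) ≤ a_2/N for every i ∈ {2,…,N}, then a_1/N ≤ Δx_i(t) ≤ a_2/N for every i ∈ {2,…,N} and every t ∈ [0,T]. -/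

import Mathlib

open MeasureTheory Set

/-- The domain `D_ℓ` of the no-flux discretisation on `[-ℓ,ℓ]` (particles indexed
`1,…,N`): `-2ℓ - x_2 < x_1 < x_2 < ⋯ < x_N < 2ℓ - x_{N-1}`. -/
def noFluxDomain (N : ℕ) (l : ℝ) : Set (ℕ → ℝ) :=
  {x | (∀ i, 1 ≤ i → i < N → x i < x (i + 1)) ∧
       -(2 * l) - x 2 < x 1 ∧ x N < 2 * l - x (N - 1)}

/-- Ball radius with no-flux conventions on `[-ℓ,ℓ]`. -/
noncomputable def noFluxR (N : ℕ) (l : ℝ) (x : ℕ → ℝ) (i : ℕ) : ℝ :=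
  if i = 1 then
    (if -l < x 1 then x 2 - x 1 else min (x 2 - x 1) (x 1 + 2 * l + x 2))
  else if i = N then
    (if x N < l then x N - x (N - 1) else min (x N - x (N - 1)) (2 * l - x (N - 1) - x N))
  else min (x i - x (i - 1)) (x (i + 1) - x i)

/-- The discrete heat energy with no-flux conventions. -/
noncomputable def noFluxEnergy (N : ℕ) (l : ℝ) (x : ℕ → ℝ) : ℝ :=
  -Real.log N - (1 / N : ℝ) * ∑ i ∈ Finset.Icc 1 N, Real.log (noFluxR N l x i)

/-- The positive part of an absolutely continuous function is absolutely continuous. -/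
lemma AbsolutelyContinuousOnInterval.max_zero {f : ℝ → ℝ} {a b : ℝ}
    (hf : AbsolutelyContinuousOnInterval f a b) :
    AbsolutelyContinuousOnInterval (fun t => max (f t) 0) a b := by
  apply squeeze_zero (fun t ↦ ?_) (fun t ↦ ?_) hf
  · exact Finset.sum_nonneg (fun i hi ↦ by positivity)
  · gcongr
    exact (LipschitzWith.id.max_const (0 : ℝ)).dist_le_mul _ _ |>.trans (by simp)

lemma hasDerivAt_max_zero_eq {f : ℝ → ℝ} {f' p t : ℝ} (hf : HasDerivAt f f' t)
    (hp : HasDerivAt (fun t => max (f t) 0) p t) : p = if 0 < f t then f' else 0 := by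
  rcases lt_or_ge 0 (f t) with h | h
  · rw [if_pos h]
    refine hp.unique (hf.congr_of_eventuallyEq ?_)
    filter_upwards [hf.continuousAt.eventually (lt_mem_nhds h)] with s hs
    exact max_eq_left hs.le
  · rw [if_neg h.not_gt]
    refine IsLocalMin.hasDerivAt_eq_zero (Filter.Eventually.of_forall fun s => ?_) hp
    simp [h]

/-- Comparison principle: if the functions `f i` start nonpositive and the total rate of change
of the positive ones is nonpositive, then all of them stay nonpositive. -/
lemma nonpos_of_ae_sum_rate_nonpos {ι : Type*} (s : Finset ι) {T : ℝ} (f g : ι → ℝ → ℝ)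
    (hg : ∀ i ∈ s, IntervalIntegrable (g i) volume 0 T)
    (hf : ∀ i ∈ s, ∀ t ∈ Icc (0 : ℝ) T, f i t = f i 0 + ∫ r in (0 : ℝ)..t, g i r)
    (h0 : ∀ i ∈ s, f i 0 ≤ 0)
    (hae : ∀ᵐ t, t ∈ Icc (0 : ℝ) T → ∑ i ∈ s, (if 0 < f i t then g i t else 0) ≤ 0) :
    ∀ t ∈ Icc (0 : ℝ) T, ∀ i ∈ s, f i t ≤ 0 := by
  intro t ht i hi
  have hT : 0 ≤ T := ht.1.trans ht.2
  set F : ι → ℝ → ℝ := fun i t => f i 0 + ∫ r in (0 : ℝ)..t, g i r with hF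
  have hac : ∀ i ∈ s, AbsolutelyContinuousOnInterval (fun t => max (F i t) 0) 0 T := by
    intro i hi
    refine AbsolutelyContinuousOnInterval.max_zero ?_
    have hc : AbsolutelyContinuousOnInterval (fun _ : ℝ => f i 0) 0 T :=
      (LipschitzWith.const (f i 0)).lipschitzOnWith.absolutelyContinuousOnInterval
    exact hc.add ((hg i hi).absolutelyContinuousOnInterval_intervalIntegral (by simp))
  have hsub : uIcc 0 t ⊆ uIcc 0 T := by
    rw [uIcc_of_le ht.1, uIcc_of_le hT]; exact Icc_subset_Icc_right ht.2
  have hact := fun i hi => (hac i hi).mono hsub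
  have hsum : ∑ i ∈ s, max (F i t) 0 = ∫ r in (0 : ℝ)..t, ∑ i ∈ s,
      deriv (fun t => max (F i t) 0) r := by
    rw [intervalIntegral.integral_finsetSum (fun i hi => (hact i hi).intervalIntegrable_deriv)]
    refine Finset.sum_congr rfl fun i hi => ?_
    rw [(hact i hi).integral_deriv_eq_sub]
    simp [hF, h0 i hi]
  have hder : ∀ᵐ r, ∀ i ∈ s, r ∈ Icc 0 T →
      deriv (fun t => max (F i t) 0) r = if 0 < f i r then g i r else 0 := by
    rw [Filter.eventually_all_finset]
    intro i hi
    filter_upwards [(hac i hi).ae_differentiableAt, (hg i hi).ae_hasDerivAt_integral]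
      with r h1 h2 hr
    rw [uIcc_of_le hT] at h1 h2
    rw [hf i hi r hr]
    exact hasDerivAt_max_zero_eq (f := F i) ((h2 hr 0 ⟨le_rfl, hT⟩).const_add _) (h1 hr).hasDerivAt
  have hle : ∫ r in (0 : ℝ)..t, ∑ i ∈ s, deriv (fun t => max (F i t) 0) r ≤ 0 := by
    rw [intervalIntegral.integral_of_le ht.1]
    refine integral_nonpos_of_ae ?_
    rw [Filter.EventuallyLE, ae_restrict_iff' measurableSet_Ioc]
    filter_upwards [hder, hae] with r h1 h2 hr
    have hr' : r ∈ Icc 0 T := ⟨hr.1.le, hr.2.trans ht.2⟩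
    rw [Finset.sum_congr rfl fun i hi => h1 i hi hr']
    exact h2 hr'
  have := Finset.single_le_sum (f := fun i => max (F i t) 0) (fun i _ => le_max_right _ _) hi
  calc f i t = F i t := hf i hi t ht
    _ ≤ max (F i t) 0 := le_max_left _ _
    _ ≤ 0 := by linarith

lemma noFluxR_one (N : ℕ) (l : ℝ) (x : ℕ → ℝ) :
    noFluxR N l x 1 = min (x 2 - x 1) (x 1 + 2 * l + x 2) := by
  unfold noFluxR; grind

lemma noFluxR_last {N : ℕ} (hN : N ≠ 1) (l : ℝ) (x : ℕ → ℝ) :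
    noFluxR N l x N = min (x N - x (N - 1)) (2 * l - x (N - 1) - x N) := by
  unfold noFluxR; grind

lemma noFluxR_interior {N i : ℕ} (h1 : i ≠ 1) (hN : i ≠ N) (l : ℝ) (x : ℕ → ℝ) :
    noFluxR N l x i = min (x i - x (i - 1)) (x (i + 1) - x i) := by
  simp [noFluxR, h1, hN]

lemma noFluxR_pos {N : ℕ} (hN : 3 ≤ N) {l : ℝ} {x : ℕ → ℝ} (hx : x ∈ noFluxDomain N l)
    {i : ℕ} (hi : i ∈ Finset.Icc 1 N) : 0 < noFluxR N l x i := by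
  obtain ⟨hord, hleft, hright⟩ := hx
  rw [Finset.mem_Icc] at hi
  rcases eq_or_ne i 1 with rfl | h1
  · have := hord 1 le_rfl (by omega)
    rw [noFluxR_one]; apply lt_min <;> grind
  rcases eq_or_ne i N with rfl | h2
  · have := hord (i - 1) (by omega) (by omega)
    rw [noFluxR_last h1]; apply lt_min <;> grind
  · have := hord (i - 1) (by omega) (by omega)
    have := hord i (by omega) (by omega)
    rw [noFluxR_interior h1 h2]; apply lt_min <;> grind

lemma sum_le_sum_of_pair {s : Finset ℕ} {f g : ℕ → ℝ} {a b : ℕ} (ha : a ∈ s) (hb : b ∈ s)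
    (hab : b ≠ a) (hpair : f a + f b ≤ g a + g b)
    (hrest : ∀ j ∈ s, j ≠ a → j ≠ b → f j ≤ g j) : ∑ j ∈ s, f j ≤ ∑ j ∈ s, g j := by
  have hb' : b ∈ s.erase a := Finset.mem_erase.2 ⟨hab, hb⟩
  rw [← Finset.add_sum_erase s f ha, ← Finset.add_sum_erase s g ha,
    ← Finset.add_sum_erase _ f hb', ← Finset.add_sum_erase _ g hb']
  have := Finset.sum_le_sum (s := (s.erase a).erase b) (f := f) (g := g) (by grind)
  linarith

/-- Bringing two lengths closer to each other increases the sum of their logarithms. -/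
lemma log_add_log_le_of_transfer {p q a b e : ℝ} (hp : 0 < p) (hb : 0 < b) (hpa : p ≤ a)
    (he : 0 < e) (hab : e ≤ a - b) (hq : min p (a - e) ≤ q) :
    Real.log p + Real.log b ≤ Real.log q + Real.log (b + e) := by
  have hq0 : 0 < q := lt_of_lt_of_le (lt_min hp (by linarith)) hq
  rw [← Real.log_mul hp.ne' hb.ne', ← Real.log_mul hq0.ne' (by positivity)]
  refine Real.log_le_log (by positivity) ?_
  rcases min_le_iff.1 hq with h | h <;> nlinarith

/-- The defining inequality of `-v ∈ ∂_w E`. -/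
def IsNoFluxVelocity (N : ℕ) (l : ℝ) (x v : ℕ → ℝ) : Prop :=
  ∀ y ∈ noFluxDomain N l, noFluxEnergy N l y ≥ noFluxEnergy N l x +
    ∑ i ∈ Finset.Icc 1 N, (-(v i) / N) * (y i - x i)

lemma IsNoFluxVelocity.mul_nonneg {N : ℕ} {l : ℝ} {x v : ℕ → ℝ}
    (hv : IsNoFluxVelocity N l x v) {k : ℕ} (hk : k ∈ Finset.Icc 1 N) {d : ℝ}
    (hy : Function.update x k (x k + d) ∈ noFluxDomain N l)
    (hlog : ∑ i ∈ Finset.Icc 1 N, Real.log (noFluxR N l x i) ≤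
      ∑ i ∈ Finset.Icc 1 N, Real.log (noFluxR N l (Function.update x k (x k + d)) i)) :
    0 ≤ v k * d := by
  have hN : (0 : ℝ) < N := by
    rw [Finset.mem_Icc] at hk
    exact_mod_cast (by omega : 0 < N)
  have h := hv _ hy
  rw [Finset.sum_eq_single_of_mem k hk (fun j _ hj => by simp [hj])] at h
  have hle := mul_le_mul_of_nonneg_left hlog (by positivity : (0 : ℝ) ≤ 1 / N)
  simp only [noFluxEnergy, Function.update_self] at h
  have h3 : -(v k) / N * (x k + d - x k) ≤ 0 := by linarith
  have h4 : -(v k) / N * (x k + d - x k) = -(v k * d) / N := by ring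
  rw [h4, div_le_iff₀ hN] at h3
  linarith

lemma IsNoFluxVelocity.first_nonpos {N : ℕ} (hN : 3 ≤ N) {l : ℝ} {x v : ℕ → ℝ}
    (hv : IsNoFluxVelocity N l x v) (hx : x ∈ noFluxDomain N l) (h1 : -l < x 1) : v 1 ≤ 0 := by
  set y := Function.update x 1 (x 1 + -(x 1 + l)) with hy
  have hyi : ∀ j, y j = if j = 1 then -l else x j := by
    intro j; simp [hy, Function.update_apply]
  have hx' := hx
  obtain ⟨hord, hleft, hright⟩ := hx'
  have h12 := hord 1 le_rfl (by omega)
  have hydom : y ∈ noFluxDomain N l := ⟨by grind, by grind, by grind⟩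
  have := hv.mul_nonneg (by simp; omega) hydom (Finset.sum_le_sum fun j hj =>
    Real.log_le_log (noFluxR_pos hN hx hj) (by
      rw [Finset.mem_Icc] at hj
      rcases eq_or_ne j 1 with rfl | hj1
      · rw [noFluxR_one, noFluxR_one]; grind
      rcases eq_or_ne j N with rfl | hj2
      · rw [noFluxR_last hj1, noFluxR_last hj1]; grind
      · rw [noFluxR_interior hj1 hj2, noFluxR_interior hj1 hj2]; grind))
  nlinarith

lemma IsNoFluxVelocity.last_nonneg {N : ℕ} (hN : 3 ≤ N) {l : ℝ} {x v : ℕ → ℝ}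
    (hv : IsNoFluxVelocity N l x v) (hx : x ∈ noFluxDomain N l) (h1 : x N < l) : 0 ≤ v N := by
  set y := Function.update x N (x N + (l - x N)) with hy
  have hyi : ∀ j, y j = if j = N then l else x j := by
    intro j; simp [hy, Function.update_apply]
  have hx' := hx
  obtain ⟨hord, hleft, hright⟩ := hx'
  have h12 := hord (N - 1) (by omega) (by omega)
  have hydom : y ∈ noFluxDomain N l := ⟨by grind, by grind, by grind⟩
  have := hv.mul_nonneg (by simp; omega) hydom (Finset.sum_le_sum fun j hj =>
    Real.log_le_log (noFluxR_pos hN hx hj) (by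
      rw [Finset.mem_Icc] at hj
      rcases eq_or_ne j 1 with rfl | hj1
      · rw [noFluxR_one, noFluxR_one]; grind
      rcases eq_or_ne j N with rfl | hj2
      · rw [noFluxR_last hj1, noFluxR_last hj1]; grind
      · rw [noFluxR_interior hj1 hj2, noFluxR_interior hj1 hj2]; grind))
  nlinarith

/-- If the left gap of an interior particle is larger than its right gap, its velocity is
nonpositive. -/
lemma IsNoFluxVelocity.nonpos_of_gap_lt {N : ℕ} {l : ℝ} {x v : ℕ → ℝ}
    (hv : IsNoFluxVelocity N l x v) (hx : x ∈ noFluxDomain N l) (h1 : x 1 = -l)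
    {k : ℕ} (hk : 2 ≤ k) (hkN : k < N) (hgap : x (k + 1) - x k < x k - x (k - 1)) :
    v k ≤ 0 := by
  have hN : 3 ≤ N := by omega
  obtain ⟨e, he⟩ : ∃ e, e = ((x k - x (k - 1)) - (x (k + 1) - x k)) / 2 := ⟨_, rfl⟩
  have hepos : 0 < e := by linarith
  set y := Function.update x k (x k + -e) with hy
  have hyi : ∀ j, y j = if j = k then x k - e else x j := by
    intro j; simp [hy, Function.update_apply, sub_eq_add_neg]
  have hyk : y k = x k - e := by simp [hyi]
  have hyk1 : y (k + 1) = x (k + 1) := by simp [hyi]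
  have hyk2 : y (k - 1) = x (k - 1) := by rw [hyi, if_neg (by omega)]
  have hx' := hx
  obtain ⟨hord, hleft, hright⟩ := hx'
  have hk1 := hord k (by omega) hkN
  have hk2 := hord (k - 1) (by omega) (by omega)
  rw [show k - 1 + 1 = k by omega] at hk2
  have hydom : y ∈ noFluxDomain N l := by
    refine ⟨fun i hi1 hi2 => ?_, ?_, ?_⟩
    · have := hord i hi1 hi2
      grind
    · grind
    · grind
  have := hv.mul_nonneg (by simp; omega) hydom (sum_le_sum_of_pair (a := k - 1) (b := k)
    (by simp; omega) (by simp; omega) (by omega) (by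
      rw [noFluxR_interior (by omega) hkN.ne l x, noFluxR_interior (by omega) hkN.ne l y,
        hyk, hyk1, hyk2, min_eq_right hgap.le, min_eq_right (by linarith), sub_sub_eq_add_sub,
        add_sub_right_comm]
      refine log_add_log_le_of_transfer (a := x k - x (k - 1))
        (noFluxR_pos hN hx (by simp; omega)) (by linarith) ?_ hepos (by linarith) ?_
      · rcases eq_or_ne (k - 1) 1 with h | h
        · rw [h, noFluxR_one]; grind
        · rw [noFluxR_interior h (by omega)]; grind
      · rcases eq_or_ne (k - 1) 1 with h | h
        · rw [h, noFluxR_one, noFluxR_one]; grind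
        · rw [noFluxR_interior h (by omega), noFluxR_interior h (by omega)]; grind)
    fun j hj hjk1 hjk => Real.log_le_log (noFluxR_pos hN hx hj) (by
      rw [Finset.mem_Icc] at hj
      rcases eq_or_ne j 1 with rfl | hj1
      · rw [noFluxR_one, noFluxR_one]; grind
      rcases eq_or_ne j N with rfl | hj2
      · rw [noFluxR_last hj1, noFluxR_last hj1]; grind
      · rw [noFluxR_interior hj1 hj2, noFluxR_interior hj1 hj2]; grind))
  nlinarith

/-- If the right gap of an interior particle is larger than its left gap, its velocity is
nonnegative. -/
lemma IsNoFluxVelocity.nonneg_of_gap_lt {N : ℕ} {l : ℝ} {x v : ℕ → ℝ}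
    (hv : IsNoFluxVelocity N l x v) (hx : x ∈ noFluxDomain N l) (hNl : x N = l)
    {k : ℕ} (hk : 2 ≤ k) (hkN : k < N) (hgap : x k - x (k - 1) < x (k + 1) - x k) :
    0 ≤ v k := by
  have hN : 3 ≤ N := by omega
  obtain ⟨e, he⟩ : ∃ e, e = ((x (k + 1) - x k) - (x k - x (k - 1))) / 2 := ⟨_, rfl⟩
  have hepos : 0 < e := by linarith
  set y := Function.update x k (x k + e) with hy
  have hyi : ∀ j, y j = if j = k then x k + e else x j := by
    intro j; simp [hy, Function.update_apply]
  have hyk : y k = x k + e := by simp [hyi]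
  have hyk1 : y (k + 1) = x (k + 1) := by simp [hyi]
  have hyk2 : y (k - 1) = x (k - 1) := by rw [hyi, if_neg (by omega)]
  have hx' := hx
  obtain ⟨hord, hleft, hright⟩ := hx'
  have hk1 := hord k (by omega) hkN
  have hk2 := hord (k - 1) (by omega) (by omega)
  rw [show k - 1 + 1 = k by omega] at hk2
  have hydom : y ∈ noFluxDomain N l := by
    refine ⟨fun i hi1 hi2 => ?_, ?_, ?_⟩
    · have := hord i hi1 hi2
      grind
    · grind
    · grind
  have := hv.mul_nonneg (by simp; omega) hydom (sum_le_sum_of_pair (a := k + 1) (b := k)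
    (by simp; omega) (by simp; omega) (by omega) (by
      rw [noFluxR_interior (i := k) (by omega) hkN.ne l x,
        noFluxR_interior (i := k) (by omega) hkN.ne l y,
        hyk, hyk1, hyk2, min_eq_left hgap.le, min_eq_left (by linarith), add_sub_right_comm]
      refine log_add_log_le_of_transfer (a := x (k + 1) - x k)
        (noFluxR_pos hN hx (by simp; omega)) (by linarith) ?_ hepos (by linarith) ?_
      · rcases eq_or_ne (k + 1) N with h | h
        · rw [h, noFluxR_last (by omega)]; grind
        · rw [noFluxR_interior (by omega) h]; grind
      · rcases eq_or_ne (k + 1) N with h | h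
        · rw [h, noFluxR_last (by omega), noFluxR_last (by omega)]; grind
        · rw [noFluxR_interior (by omega) h, noFluxR_interior (by omega) h]; grind)
    fun j hj hjk1 hjk => Real.log_le_log (noFluxR_pos hN hx hj) (by
      rw [Finset.mem_Icc] at hj
      rcases eq_or_ne j 1 with rfl | hj1
      · rw [noFluxR_one, noFluxR_one]; grind
      rcases eq_or_ne j N with rfl | hj2
      · rw [noFluxR_last hj1, noFluxR_last hj1]; grind
      · rw [noFluxR_interior hj1 hj2, noFluxR_interior hj1 hj2]; grind))
  nlinarith

/-- Summation by parts, as an inequality. -/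
lemma sum_mul_sub_le {c w : ℕ → ℝ} (hw : w 1 = 0) {n : ℕ} (hn : 1 ≤ n)
    (h : ∀ i, 2 ≤ i → i ≤ n → (c i - c (i + 1)) * w i ≤ 0) :
    ∑ i ∈ Finset.Icc 2 (n + 1), c i * (w i - w (i - 1)) ≤ c (n + 1) * w (n + 1) := by
  induction n, hn using Nat.le_induction with
  | base => simp [hw]
  | succ n hn ih =>
    rw [Finset.sum_Icc_succ_top (by omega)]
    have h1 := ih fun i h2 hi => h i h2 (by omega)
    have h2 := h (n + 1) (by omega) le_rfl
    simp only [Nat.add_sub_cancel]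
    linarith

/-- If the end particles are fixed and each interior particle moves towards its larger adjacent
gap, then an upper (`σ = 1`) or lower (`σ = -1`) bound on all gaps is preserved. -/
lemma gap_sign_preserved {N : ℕ} (hN : 3 ≤ N) {T : ℝ} {x v : ℝ → ℕ → ℝ}
    (hvint : ∀ i, IntervalIntegrable (fun s => v s i) volume 0 T)
    (hftc : ∀ t ∈ Icc (0 : ℝ) T, ∀ i, x t i = x 0 i + ∫ s in (0 : ℝ)..t, v s i)
    (hfix : ∀ t ∈ Icc (0 : ℝ) T, x t 1 = x 0 1 ∧ x t N = x 0 N)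
    (hae : ∀ᵐ t, t ∈ Icc (0 : ℝ) T → ∀ k, 2 ≤ k → k < N →
      (x t (k + 1) - x t k < x t k - x t (k - 1) → v t k ≤ 0) ∧
      (x t k - x t (k - 1) < x t (k + 1) - x t k → 0 ≤ v t k))
    {σ A : ℝ} (hσ : σ = 1 ∨ σ = -1)
    (h0 : ∀ i, 2 ≤ i → i ≤ N → σ * (x 0 i - x 0 (i - 1) - A) ≤ 0) :
    ∀ t ∈ Icc (0 : ℝ) T, ∀ i, 2 ≤ i → i ≤ N → σ * (x t i - x t (i - 1) - A) ≤ 0 := by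
  set w : ℝ → ℕ → ℝ := fun t i => if 2 ≤ i ∧ i < N then v t i else 0 with hw
  have hwint : ∀ i, IntervalIntegrable (fun s => w s i) volume 0 T := by
    intro i
    by_cases hi : 2 ≤ i ∧ i < N
    · simpa [hw, hi] using hvint i
    · simp [hw, hi]
  have hwftc : ∀ t ∈ Icc (0 : ℝ) T, ∀ i, 1 ≤ i → i ≤ N →
      x t i = x 0 i + ∫ s in (0 : ℝ)..t, w s i := by
    intro t ht i h1 h2
    by_cases hi : 2 ≤ i ∧ i < N
    · simpa [hw, hi] using hftc t ht i
    · have : i = 1 ∨ i = N := by omega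
      rcases this with rfl | rfl <;> simp [hw, hfix t ht]
  intro t ht i hi1 hi2
  refine nonpos_of_ae_sum_rate_nonpos (Finset.Icc 2 N)
    (fun i t => σ * (x t i - x t (i - 1) - A)) (fun i t => σ * (w t i - w t (i - 1)))
    (fun i _ => ((hwint i).sub (hwint (i - 1))).const_mul σ) ?_ ?_ ?_ t ht i (by simp; omega)
  · intro i hi t ht
    rw [Finset.mem_Icc] at hi
    have hsub : ∀ j, IntervalIntegrable (fun s => w s j) volume 0 t := fun j =>
      (hwint j).mono_set (by
        rw [uIcc_of_le ht.1, uIcc_of_le (ht.1.trans ht.2)]; exact Icc_subset_Icc_right ht.2)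
    rw [intervalIntegral.integral_const_mul, intervalIntegral.integral_sub (hsub _) (hsub _),
      hwftc t ht i (by omega) hi.2, hwftc t ht (i - 1) (by omega) (by omega)]
    ring
  · intro i hi
    rw [Finset.mem_Icc] at hi
    exact h0 i hi.1 hi.2
  · filter_upwards [hae] with t hsign ht
    obtain ⟨n, rfl⟩ : ∃ n, N = n + 1 := ⟨N - 1, by omega⟩
    have key := sum_mul_sub_le (n := n)
      (c := fun i => if 0 < σ * (x t i - x t (i - 1) - A) then 1 else 0)
      (w := fun i => σ * w t i) (by simp [hw]) (by omega) (by
        intro k hk1 hk2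
        obtain ⟨hs1, hs2⟩ := hsign ht k hk1 (by omega)
        have hwk : w t k = v t k := if_pos ⟨hk1, by omega⟩
        simp only [hwk, Nat.add_sub_cancel]
        rcases hσ with rfl | rfl <;> split_ifs <;> grind)
    have hlast : w t (n + 1) = 0 := by simp [hw]
    simp only [hlast, mul_zero] at key
    refine le_of_eq_of_le (Finset.sum_congr rfl fun i _ => ?_) key
    split_ifs <;> ring

/-- Along a discrete gradient flow for the no-flux heat energy
(`x` absolutely continuous with a.e. derivative `v` and `x'(t) ∈ -∂_w E_N^ℓ(x(t))`
a.e.), starting from a well-prepared configuration with `x_1(0) = -ℓ`, `x_N(0) = ℓ`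
and `a₁/N ≤ Δx_i(0) ≤ a₂/N`, the inter-particle distances satisfy
`a₁/N ≤ Δx_i(t) ≤ a₂/N` for all `i ∈ {2,…,N}` and all `t ∈ [0,T]`. -/
theorem noflux_interparticle_bounds (l : ℝ) (hl : 0 < l) (N : ℕ) (hN : 3 ≤ N)
    (T : ℝ) (hT : 0 < T) (a1 a2 : ℝ) (ha1 : 0 < a1) (ha12 : a1 ≤ a2)
    (x v : ℝ → ℕ → ℝ)
    (hdom : ∀ t ∈ Icc (0 : ℝ) T, x t ∈ noFluxDomain N l)
    (hbox : ∀ t ∈ Icc (0 : ℝ) T, -l ≤ x t 1 ∧ x t N ≤ l)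
    (hvint : ∀ i, IntervalIntegrable (fun s => v s i) volume 0 T)
    (hftc : ∀ t ∈ Icc (0 : ℝ) T, ∀ i, x t i = x 0 i + ∫ s in (0 : ℝ)..t, v s i)
    (hincl : ∀ᵐ t ∂(volume.restrict (Icc (0 : ℝ) T)),
      ∀ y ∈ noFluxDomain N l,
        noFluxEnergy N l y ≥ noFluxEnergy N l (x t) +
          ∑ i ∈ Finset.Icc 1 N, (-(v t i) / N) * (y i - x t i))
    (h10 : x 0 1 = -l) (hN0 : x 0 N = l)
    (hwp : ∀ i, 2 ≤ i → i ≤ N → a1 / N ≤ x 0 i - x 0 (i - 1) ∧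
      x 0 i - x 0 (i - 1) ≤ a2 / N) :
    ∀ t ∈ Icc (0 : ℝ) T, ∀ i, 2 ≤ i → i ≤ N →
      a1 / N ≤ x t i - x t (i - 1) ∧ x t i - x t (i - 1) ≤ a2 / N := by
  have hvel : ∀ᵐ t, t ∈ Icc (0 : ℝ) T → IsNoFluxVelocity N l (x t) (v t) :=
    (ae_restrict_iff' measurableSet_Icc).1 hincl
  have hfirst : ∀ t ∈ Icc (0 : ℝ) T, x t 1 = -l := by
    intro t ht
    have := nonpos_of_ae_sum_rate_nonpos (Finset.univ : Finset Unit) (T := T)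
      (fun _ t => x t 1 + l) (fun _ t => v t 1) (fun _ _ => hvint 1)
      (fun _ _ t ht => by linarith [hftc t ht 1]) (fun _ _ => by simp [h10])
      (by
        filter_upwards [hvel] with t hv ht
        simp only [Finset.univ_unique, Finset.sum_const, Finset.card_singleton, one_smul]
        split_ifs with h
        · exact (hv ht).first_nonpos hN (hdom t ht) (by linarith)
        · exact le_rfl) t ht () (Finset.mem_univ _)
    linarith [(hbox t ht).1]
  have hlast : ∀ t ∈ Icc (0 : ℝ) T, x t N = l := by
    intro t ht
    have := nonpos_of_ae_sum_rate_nonpos (Finset.univ : Finset Unit) (T := T)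
      (fun _ t => l - x t N) (fun _ t => -v t N) (fun _ _ => (hvint N).neg)
      (fun _ _ t ht => by
        rw [intervalIntegral.integral_neg]
        linarith [hftc t ht N]) (fun _ _ => by simp [hN0])
      (by
        filter_upwards [hvel] with t hv ht
        simp only [Finset.univ_unique, Finset.sum_const, Finset.card_singleton, one_smul]
        split_ifs with h
        · linarith [(hv ht).last_nonneg hN (hdom t ht) (by linarith)]
        · exact le_rfl) t ht () (Finset.mem_univ _)
    linarith [(hbox t ht).2]
  have hfix : ∀ t ∈ Icc (0 : ℝ) T, x t 1 = x 0 1 ∧ x t N = x 0 N := fun t ht =>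
    ⟨(hfirst t ht).trans h10.symm, (hlast t ht).trans hN0.symm⟩
  have hsign : ∀ᵐ t, t ∈ Icc (0 : ℝ) T → ∀ k, 2 ≤ k → k < N →
      (x t (k + 1) - x t k < x t k - x t (k - 1) → v t k ≤ 0) ∧
      (x t k - x t (k - 1) < x t (k + 1) - x t k → 0 ≤ v t k) := by
    filter_upwards [hvel] with t hv ht k hk hkN
    exact ⟨(hv ht).nonpos_of_gap_lt (hdom t ht) (hfirst t ht) hk hkN,
      (hv ht).nonneg_of_gap_lt (hdom t ht) (hlast t ht) hk hkN⟩
  intro t ht i hi1 hi2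
  have hupper := gap_sign_preserved hN hvint hftc hfix hsign (σ := 1) (A := a2 / N) (.inl rfl)
    (fun i h1 h2 => by linarith [(hwp i h1 h2).2]) t ht i hi1 hi2
  have hlower := gap_sign_preserved hN hvint hftc hfix hsign (σ := -1) (A := a1 / N) (.inr rfl)
    (fun i h1 h2 => by linarith [(hwp i h1 h2).1]) t ht i hi1 hi2
  constructor <;> linarith
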